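/- arXiv:1810.05015 — 5 statements merged into one kernel-verified Lean document; each statement's English description precedes it below -/
import Mathlib

section
/- Let n ≥ 2 be an integer, θ ≥ 0 a real number and α, β ∈ (0,1). Define a_n = (β−α)/(2n^θ + n − 2) and b_n = a_n(n^θ − 1) + α, and let ρ_ss: {0,1,…,n} → ℝ be given by ρ_ss(0) = α, ρ_ss(n) = β and ρ_ss(x) = a_n x + b_n for x ∈ {1,…,n−1}. Then (𝔅_n^θ ρ_ss)(x) = 0 for every x ∈ {1,…,n−1}; that is, ρ_ss is the stationary solution of the discrete slow-boundary heat equation. -/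
/-- The jump rates `ξ^{n,θ}_{x,y}` of the slow-boundary random walk on `{0,…,n}`:
rate `1` between nearest neighbours inside `Σ_n = {1,…,n−1}`, rate `n^{−θ}` for the
boundary jumps `1 → 0` and `n−1 → n`, and `0` otherwise. -/
noncomputable def xiRate (n : ℕ) (θ : ℝ) (x y : ℕ) : ℝ :=
  if (x + 1 = y ∨ y + 1 = x) ∧ 1 ≤ x ∧ x ≤ n - 1 ∧ 1 ≤ y ∧ y ≤ n - 1 then 1
  else if (x = 1 ∧ y = 0) ∨ (x = n - 1 ∧ y = n) then (n : ℝ) ^ (-θ)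
  else 0

/-- The slow-boundary operator `𝔅_n^θ` acting on functions `f : {0,…,n} → ℝ`. -/
noncomputable def Bop (n : ℕ) (θ : ℝ) (f : ℕ → ℝ) (x : ℕ) : ℝ :=
  ∑ y ∈ Finset.range (n + 1), xiRate n θ x y * (f y - f x)

/-- At a site `k + 1` of `Σ_n`, only the two neighbours `k` and `k + 2` contribute to `𝔅_n^θ`. -/
lemma Bop_succ (n : ℕ) (θ : ℝ) (f : ℕ → ℝ) (k : ℕ) (hk : k + 2 ≤ n) :
    Bop n θ f (k + 1) = xiRate n θ (k + 1) k * (f k - f (k + 1)) +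
      xiRate n θ (k + 1) (k + 2) * (f (k + 2) - f (k + 1)) := by
  have hsub : ({k, k + 2} : Finset ℕ) ⊆ Finset.range (n + 1) := by
    intro y hy
    simp only [Finset.mem_insert, Finset.mem_singleton] at hy
    simp only [Finset.mem_range]
    omega
  unfold Bop
  rw [← Finset.sum_subset hsub, Finset.sum_pair (by omega)]
  intro y _ hy
  simp only [Finset.mem_insert, Finset.mem_singleton, not_or] at hy
  rw [xiRate, if_neg (by omega), if_neg (by omega), zero_mul]

/-- The profile `ρ_ss(x) = a_n x + b_n`, with boundary values `α` and `β`, is harmonic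
for the slow-boundary operator `𝔅_n^θ`: `(𝔅_n^θ ρ_ss)(x) = 0` for every `x ∈ {1,…,n−1}`. -/
theorem stationary_profile_is_harmonic (n : ℕ) (hn : 2 ≤ n) (θ : ℝ) (hθ : 0 ≤ θ)
    (α β : ℝ) (hα : α ∈ Set.Ioo (0 : ℝ) 1) (hβ : β ∈ Set.Ioo (0 : ℝ) 1)
    (a b : ℝ)
    (ha : a = (β - α) / (2 * (n : ℝ) ^ θ + n - 2))
    (hb : b = a * ((n : ℝ) ^ θ - 1) + α)
    (ρ : ℕ → ℝ)
    (hρ0 : ρ 0 = α) (hρn : ρ n = β)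
    (hρ : ∀ x : ℕ, 1 ≤ x → x ≤ n - 1 → ρ x = a * x + b) :
    ∀ x : ℕ, 1 ≤ x → x ≤ n - 1 → Bop n θ ρ x = 0 := by
  intro x hx1 hxn
  obtain ⟨k, rfl⟩ : ∃ k, x = k + 1 := ⟨x - 1, by omega⟩
  have hn0 : (0 : ℝ) < n := by exact_mod_cast (by omega : 0 < n)
  have hn2 : (2 : ℝ) ≤ n := by exact_mod_cast hn
  have hN : 0 < (n : ℝ) ^ θ := Real.rpow_pos_of_pos hn0 θ
  have hneg : (n : ℝ) ^ (-θ) = ((n : ℝ) ^ θ)⁻¹ := Real.rpow_neg hn0.le θ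
  have hx := hρ (k + 1) hx1 hxn
  push_cast at hx
  have hab : a * (2 * (n : ℝ) ^ θ + n - 2) = β - α := by
    rw [ha]
    exact div_mul_cancel₀ _ (by linarith : 0 < 2 * (n : ℝ) ^ θ + n - 2).ne'
  have hleft : xiRate n θ (k + 1) k * (ρ k - ρ (k + 1)) = -a := by
    rcases Nat.eq_zero_or_pos k with rfl | hk
    · rw [xiRate, if_neg (by omega), if_pos (by omega), hneg, inv_mul_eq_iff_eq_mul₀ hN.ne',
        hx, hρ0, hb]
      push_cast
      ring
    · rw [xiRate, if_pos (by omega), hx, hρ k hk (by omega)]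
      ring
  have hright : xiRate n θ (k + 1) (k + 2) * (ρ (k + 2) - ρ (k + 1)) = a := by
    rcases (by omega : n = k + 2 ∨ k + 2 ≤ n - 1) with hk | hk
    · have hkn : (n : ℝ) = k + 2 := by exact_mod_cast hk
      rw [xiRate, if_neg (by omega), if_pos (by omega), hneg, inv_mul_eq_iff_eq_mul₀ hN.ne',
        hx, ← hk, hρn, hb]
      linear_combination -hab + a * hkn
    · rw [xiRate, if_pos (by omega), hx, hρ (k + 2) (by omega) hk]
      push_cast
      ring
  rw [Bop_succ n θ ρ k (by omega), hleft, hright, neg_add_cancel]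
end

section
/- Let θ ≥ 0 be real and α, β ∈ (0,1). For each integer n ≥ 2 set a_n = (β−α)/(2n^θ + n − 2), b_n = a_n(n^θ − 1) + α and ρ_ss^n(x) = a_n x + b_n. Define ρ̄: [0,1] → ℝ by ρ̄(u) = (β−α)u + α if θ < 1, ρ̄(u) = ((β−α)/3)u + α + (β−α)/3 if θ = 1, and ρ̄(u) = (β+α)/2 if θ > 1. Then lim_{n→∞} max_{x∈{1,…,n−1}} |ρ_ss^n(x) − ρ̄(x/n)| = 0. -/
open Filter Topology

/-- An affine function of `x ∈ {1,…,n-1}` whose coefficients converge after rescaling is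
uniformly close to the limiting affine function of `x / n`. -/
theorem affine_uniform_limit {a b : ℕ → ℝ} {A B : ℝ}
    (ha : Tendsto (fun n : ℕ => (n : ℝ) * a n) atTop (𝓝 A)) (hb : Tendsto b atTop (𝓝 B)) :
    ∀ ε > (0 : ℝ), ∃ N : ℕ, ∀ n ≥ N, ∀ x : ℕ, 1 ≤ x → x ≤ n - 1 →
      |a n * x + b n - (A * ((x : ℝ) / n) + B)| < ε := by
  intro ε hε
  obtain ⟨N₁, h₁⟩ := Metric.tendsto_atTop.1 ha (ε / 2) (half_pos hε)
  obtain ⟨N₂, h₂⟩ := Metric.tendsto_atTop.1 hb (ε / 2) (half_pos hε)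
  refine ⟨max N₁ N₂, fun n hn x hx1 hxn => ?_⟩
  have h₁ := h₁ n (le_of_max_le_left hn)
  have h₂ := h₂ n (le_of_max_le_right hn)
  rw [Real.dist_eq] at h₁ h₂
  have hn0 : (0 : ℝ) < n := by
    have : 0 < n := by omega
    exact_mod_cast this
  have hu0 : (0 : ℝ) ≤ (x : ℝ) / n := by positivity
  have hu1 : (x : ℝ) / n ≤ 1 := by
    rw [div_le_one hn0]
    have : x ≤ n := by omega
    exact_mod_cast this
  have key : a n * x + b n - (A * ((x : ℝ) / n) + B)
      = (n * a n - A) * ((x : ℝ) / n) + (b n - B) := by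
    field_simp
    ring
  calc |a n * x + b n - (A * ((x : ℝ) / n) + B)|
      ≤ |n * a n - A| * ((x : ℝ) / n) + |b n - B| := by
        rw [key]
        refine (abs_add_le _ _).trans_eq ?_
        rw [abs_mul, abs_of_nonneg hu0]
    _ ≤ |n * a n - A| + |b n - B| := by
        gcongr
        exact mul_le_of_le_one_right (abs_nonneg _) hu1
    _ < ε := by linarith

/-- Limits of the rescaled slope and of the intercept of the stationary profile, with `t n` in the
role of `n ^ θ` and `m n` the larger of the two scales `t n` and `n`. -/
theorem stationary_coeff_limits {t m : ℕ → ℝ} {p q : ℝ} (α c : ℝ) (hpq : 2 * p + q ≠ 0)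
    (hm : Tendsto m atTop atTop) (ht : Tendsto (fun n => t n / m n) atTop (𝓝 p))
    (hn : Tendsto (fun n : ℕ => (n : ℝ) / m n) atTop (𝓝 q)) :
    Tendsto (fun n : ℕ => (n : ℝ) * (c / (2 * t n + n - 2))) atTop (𝓝 (c * q / (2 * p + q))) ∧
    Tendsto (fun n : ℕ => c / (2 * t n + n - 2) * (t n - 1) + α) atTop
      (𝓝 (c * p / (2 * p + q) + α)) := by
  have hm0 : ∀ᶠ n in atTop, m n ≠ 0 := hm.eventually_ne_atTop 0
  have hinv : Tendsto (fun n => (m n)⁻¹) atTop (𝓝 0) := tendsto_inv_atTop_zero.comp hm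
  have hden : Tendsto (fun n : ℕ => 2 * (t n / m n) + n / m n - 2 * (m n)⁻¹) atTop
      (𝓝 (2 * p + q)) := by
    simpa using ((ht.const_mul 2).add hn).sub (hinv.const_mul 2)
  have hden_eq : ∀ n : ℕ, 2 * (t n / m n) + n / m n - 2 * (m n)⁻¹
      = (2 * t n + n - 2) / m n := fun n => by ring
  constructor
  · refine ((hn.const_mul c).div hden hpq).congr' ?_
    filter_upwards [hm0] with n h
    simp only [Pi.div_apply]
    rw [hden_eq, ← mul_div_assoc, div_div_div_cancel_right₀ h]
    ring
  · have hnum : Tendsto (fun n => c * (t n / m n - (m n)⁻¹)) atTop (𝓝 (c * p)) := by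
      simpa using (ht.sub hinv).const_mul c
    refine ((hnum.div hden hpq).congr' ?_).add_const α
    filter_upwards [hm0] with n h
    have hnum_eq : c * (t n / m n - (m n)⁻¹) = c * (t n - 1) / m n := by ring
    simp only [Pi.div_apply]
    rw [hden_eq, hnum_eq, div_div_div_cancel_right₀ h]
    ring

theorem tendsto_natCast_rpow_div_rpow {r s : ℝ} (h : r < s) :
    Tendsto (fun n : ℕ => (n : ℝ) ^ r / (n : ℝ) ^ s) atTop (𝓝 0) := by
  refine ((tendsto_rpow_neg_atTop (sub_pos.2 h)).comp tendsto_natCast_atTop_atTop).congr' ?_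
  filter_upwards [eventually_gt_atTop 0] with n hn
  have hn0 : (0 : ℝ) < n := by exact_mod_cast hn
  rw [Function.comp_apply, neg_sub, Real.rpow_sub hn0]

theorem tendsto_div_self_of_atTop {m : ℕ → ℝ} (hm : Tendsto m atTop atTop) :
    Tendsto (fun n => m n / m n) atTop (𝓝 1) := by
  refine tendsto_const_nhds.congr' ?_
  filter_upwards [hm.eventually_ne_atTop 0] with n hn
  rw [div_self hn]

/-- The stationary profile `ρ_ss^n(x) = a_n x + b_n` of the slow-boundary discrete heat
equation converges uniformly over `x ∈ {1,…,n−1}` to `ρ̄(x/n)`, where `ρ̄` depends on the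
regime of `θ`. -/
theorem stationary_profile_limit (θ : ℝ) (hθ : 0 ≤ θ)
    (α β : ℝ) (hα : α ∈ Set.Ioo (0 : ℝ) 1) (hβ : β ∈ Set.Ioo (0 : ℝ) 1)
    (a b : ℕ → ℝ)
    (ha : ∀ n : ℕ, a n = (β - α) / (2 * (n : ℝ) ^ θ + n - 2))
    (hb : ∀ n : ℕ, b n = a n * ((n : ℝ) ^ θ - 1) + α)
    (ρ : ℕ → ℕ → ℝ)
    (hρ : ∀ n x : ℕ, ρ n x = a n * x + b n)
    (ρbar : ℝ → ℝ)
    (hρbar : ∀ u : ℝ, ρbar u =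
      if θ < 1 then (β - α) * u + α
      else if θ = 1 then ((β - α) / 3) * u + α + (β - α) / 3
      else (β + α) / 2) :
    ∀ ε > (0 : ℝ), ∃ N : ℕ, ∀ n ≥ N, ∀ x : ℕ, 1 ≤ x → x ≤ n - 1 →
      |ρ n x - ρbar ((x : ℝ) / n)| < ε := by
  have hcast : Tendsto (fun n : ℕ => (n : ℝ)) atTop atTop := tendsto_natCast_atTop_atTop
  obtain rfl : a = _ := funext ha
  obtain rfl : b = _ := funext hb
  have reduce : ∀ {m : ℕ → ℝ} {p q : ℝ}, 2 * p + q ≠ 0 → Tendsto m atTop atTop →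
      Tendsto (fun n : ℕ => (n : ℝ) ^ θ / m n) atTop (𝓝 p) →
      Tendsto (fun n : ℕ => (n : ℝ) / m n) atTop (𝓝 q) →
      (∀ u, ρbar u = (β - α) * q / (2 * p + q) * u + ((β - α) * p / (2 * p + q) + α)) →
      ∀ ε > (0 : ℝ), ∃ N : ℕ, ∀ n ≥ N, ∀ x : ℕ, 1 ≤ x → x ≤ n - 1 →
        |ρ n x - ρbar ((x : ℝ) / n)| < ε := by
    intro m p q hpq hm ht hn hbar
    obtain ⟨h₁, h₂⟩ := stationary_coeff_limits α (β - α) hpq hm ht hn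
    simpa only [hρ, hbar] using affine_uniform_limit h₁ h₂
  rcases lt_trichotomy θ 1 with h | rfl | h
  · refine reduce (p := 0) (q := 1) (by norm_num) hcast
      (by simpa using tendsto_natCast_rpow_div_rpow h) (tendsto_div_self_of_atTop hcast) ?_
    intro u
    rw [hρbar, if_pos h]
    ring
  · refine reduce (p := 1) (q := 1) (by norm_num) hcast
      (by simpa using tendsto_div_self_of_atTop hcast) (tendsto_div_self_of_atTop hcast) ?_
    intro u
    rw [hρbar, if_neg (lt_irrefl _), if_pos rfl]
    ring
  · have hpow : Tendsto (fun n : ℕ => (n : ℝ) ^ θ) atTop atTop :=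
      (tendsto_rpow_atTop (zero_lt_one.trans h)).comp hcast
    refine reduce (p := 1) (q := 0) (by norm_num) hpow (tendsto_div_self_of_atTop hpow)
      (by simpa using tendsto_natCast_rpow_div_rpow h) ?_
    intro u
    rw [hρbar, if_neg h.not_gt, if_neg h.ne']
    ring
end

section
/- Let n ≥ 4 be an integer, θ ≥ 0 real and α, β ∈ (0,1). Define φ_ss: V_n ∪ ∂V_n → ℝ by φ_ss(x,y) = −(α−β)²(x + n^θ − 1)(n − y + n^θ − 1) / ((2n^θ + n − 2)²(2n^θ + n − 3)) for (x,y) ∈ V_n and φ_ss ≡ 0 on ∂V_n, and set a_n = (β−α)/(2n^θ + n − 2). Then for every (x,y) ∈ V_n one has n²(𝒜_n^θ φ_ss)(x,y) = (n a_n)² if y = x+1 and n²(𝒜_n^θ φ_ss)(x,y) = 0 if y > x+1; that is, φ_ss solves the stationary discrete two-point correlation equation n²𝒜_n^θ φ + g_ss = 0 with source g_ss(x,y) = −(n a_n)² 1_{y=x+1}. -/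
/-- The jump rate `c_n^θ(u,v)` of the two-dimensional slow-boundary random walk,
as a function of the target site `v` (for `v` a coordinate nearest neighbour of a
point of `V_n`): rate `1` into `V_n = {(x,y) : 0 < x < y < n}`, rate `n^{−θ}` into
`∂V_n = {(x,y) ∈ {0,…,n}² : x = 0 or y = n}`, and `0` otherwise. -/
noncomputable def cRate (n : ℕ) (θ : ℝ) (v : ℕ × ℕ) : ℝ :=
  if 0 < v.1 ∧ v.1 < v.2 ∧ v.2 < n then 1
  else if v.1 ≤ n ∧ v.2 ≤ n ∧ (v.1 = 0 ∨ v.2 = n) then (n : ℝ) ^ (-θ)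
  else 0

/-- The operator `𝒜_n^θ` acting on functions `f : V_n ∪ ∂V_n → ℝ`, at a point of `V_n`. -/
noncomputable def Aop (n : ℕ) (θ : ℝ) (f : ℕ × ℕ → ℝ) (p : ℕ × ℕ) : ℝ :=
  cRate n θ (p.1 + 1, p.2) * (f (p.1 + 1, p.2) - f p)
  + cRate n θ (p.1 - 1, p.2) * (f (p.1 - 1, p.2) - f p)
  + cRate n θ (p.1, p.2 + 1) * (f (p.1, p.2 + 1) - f p)
  + cRate n θ (p.1, p.2 - 1) * (f (p.1, p.2 - 1) - f p)

theorem cRate_of_interior {n x y : ℕ} (θ : ℝ) (hx : 0 < x) (hxy : x < y) (hy : y < n) :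
    cRate n θ (x, y) = 1 := by
  simp [cRate, hx, hxy, hy]

theorem cRate_of_boundary {n x y : ℕ} (θ : ℝ) (hx : x ≤ n) (hy : y ≤ n) (h : x = 0 ∨ y = n) :
    cRate n θ (x, y) = (n : ℝ) ^ (-θ) := by
  have h' : ¬(0 < x ∧ x < y ∧ y < n) := by omega
  simp only [cRate, if_neg h']
  rw [if_pos ⟨hx, hy, h⟩]

theorem cRate_diagonal {n x : ℕ} (θ : ℝ) (hx : 0 < x) (hxn : x < n) :
    cRate n θ (x, x) = 0 := by
  have h₁ : ¬(0 < x ∧ x < x ∧ x < n) := by omega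
  have h₂ : ¬(x ≤ n ∧ x ≤ n ∧ (x = 0 ∨ x = n)) := by omega
  simp only [cRate, if_neg h₁, if_neg h₂]

/-- If `f` vanishes on the boundary and is the product of affine functions
`-K (x + n^θ - 1) (n - y + n^θ - 1)` on `V_n`, then `𝒜_n^θ f` is supported on the upper
diagonal. -/
theorem Aop_of_affine_product {n : ℕ} (hn : 0 < n) (θ K : ℝ) {f : ℕ × ℕ → ℝ}
    (hfV : ∀ x y : ℕ, 0 < x → x < y → y < n →
      f (x, y) = -K * ((x : ℝ) + (n : ℝ) ^ θ - 1) * ((n : ℝ) - y + (n : ℝ) ^ θ - 1))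
    (hfB : ∀ x y : ℕ, x ≤ n → y ≤ n → (x = 0 ∨ y = n) → f (x, y) = 0)
    {x y : ℕ} (hx : 0 < x) (hxy : x < y) (hy : y < n) :
    Aop n θ f (x, y) = if y = x + 1 then K * (2 * (n : ℝ) ^ θ + n - 3) else 0 := by
  have hN : (n : ℝ) ^ (-θ) * (n : ℝ) ^ θ = 1 := by
    rw [← Real.rpow_add (by exact_mod_cast hn)]
    simp
  have left : cRate n θ (x - 1, y) * (f (x - 1, y) - f (x, y))
      = K * ((n : ℝ) - y + (n : ℝ) ^ θ - 1) := by
    rcases Nat.eq_or_lt_of_le hx with rfl | h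
    · rw [cRate_of_boundary θ (by omega) hy.le (by simp),
        hfB _ _ (by omega) hy.le (by simp), hfV _ _ hx hxy hy]
      push_cast
      linear_combination K * ((n : ℝ) - y + (n : ℝ) ^ θ - 1) * hN
    · rw [cRate_of_interior θ (by omega) (by omega) hy,
        hfV _ _ (by omega) (by omega) hy, hfV _ _ hx hxy hy, Nat.cast_pred hx]
      ring
  have up : cRate n θ (x, y + 1) * (f (x, y + 1) - f (x, y))
      = K * ((x : ℝ) + (n : ℝ) ^ θ - 1) := by
    rcases Nat.eq_or_lt_of_le hy with h | h
    · have hc : (n : ℝ) = y + 1 := by exact_mod_cast h.symm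
      rw [cRate_of_boundary θ (by omega) hy (Or.inr h),
        hfB _ _ (by omega) hy (Or.inr h), hfV _ _ hx hxy hy]
      linear_combination K * ((x : ℝ) + (n : ℝ) ^ θ - 1) * hN
        + (n : ℝ) ^ (-θ) * K * ((x : ℝ) + (n : ℝ) ^ θ - 1) * hc
    · rw [cRate_of_interior θ hx (by omega) h,
        hfV _ _ hx (by omega) h, hfV _ _ hx hxy hy]
      push_cast
      ring
  simp only [Aop]
  rw [left, up]
  split_ifs with h
  · subst h
    rw [cRate_diagonal θ (by omega) hy, Nat.add_sub_cancel, cRate_diagonal θ hx (by omega)]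
    push_cast
    ring
  · rw [cRate_of_interior θ (by omega) (by omega) hy,
      cRate_of_interior θ hx (by omega) (by omega),
      hfV (x + 1) y (by omega) (by omega) hy, hfV x (y - 1) hx (by omega) (by omega),
      hfV _ _ hx hxy hy, Nat.cast_pred (by omega : 0 < y)]
    push_cast
    ring

/-- The stationary two-point correlation function `φ_ss` solves the stationary discrete
two-point correlation equation: `n²(𝒜_n^θ φ_ss)(x,y) = (n a_n)²` on the diagonal
`y = x + 1` and `= 0` for `y > x + 1`. -/
theorem stationary_correlation_equation (n : ℕ) (hn : 4 ≤ n) (θ : ℝ) (hθ : 0 ≤ θ)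
    (α β : ℝ) (hα : α ∈ Set.Ioo (0 : ℝ) 1) (hβ : β ∈ Set.Ioo (0 : ℝ) 1)
    (a : ℝ) (ha : a = (β - α) / (2 * (n : ℝ) ^ θ + n - 2))
    (φ : ℕ × ℕ → ℝ)
    (hφV : ∀ x y : ℕ, 0 < x → x < y → y < n →
      φ (x, y) = -(α - β) ^ 2 * ((x : ℝ) + (n : ℝ) ^ θ - 1) * ((n : ℝ) - y + (n : ℝ) ^ θ - 1)
        / ((2 * (n : ℝ) ^ θ + n - 2) ^ 2 * (2 * (n : ℝ) ^ θ + n - 3)))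
    (hφB : ∀ x y : ℕ, x ≤ n → y ≤ n → (x = 0 ∨ y = n) → φ (x, y) = 0) :
    ∀ x y : ℕ, 0 < x → x < y → y < n →
      (n : ℝ) ^ 2 * Aop n θ φ (x, y) = if y = x + 1 then ((n : ℝ) * a) ^ 2 else 0 := by
  intro x y hx hxy hy
  have hn' : (4 : ℝ) ≤ n := by exact_mod_cast hn
  have hN : 1 ≤ (n : ℝ) ^ θ := Real.one_le_rpow (by linarith) hθ
  have h₂ : 2 * (n : ℝ) ^ θ + n - 2 ≠ 0 := by
    apply ne_of_gt
    linarith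
  have h₃ : 2 * (n : ℝ) ^ θ + n - 3 ≠ 0 := by
    apply ne_of_gt
    linarith
  rw [Aop_of_affine_product (by omega) θ
    ((α - β) ^ 2 / ((2 * (n : ℝ) ^ θ + n - 2) ^ 2 * (2 * (n : ℝ) ^ θ + n - 3)))
    (fun x y hx hxy hy => by rw [hφV x y hx hxy hy]; ring) hφB hx hxy hy, ha]
  split_ifs
  · field_simp
    ring
  · simp
end

section
/- There is a universal constant C (one may take C = 8) such that for every integer n ≥ 2 and every δ ∈ [0,1]: Σ_{ℓ=1}^{n−1} (v_ℓ^n(1))² / (λ_ℓ^n)^{1−δ} ≤ C n^{2δ−2}, where v_ℓ^n(1) = √(2/n)·sin(πℓ/n) and λ_ℓ^n = 4n²sin²(πℓ/(2n)). -/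
/-- If `0 < s ≤ 4` and `0 ≤ δ ≤ 1`, then `s / s ^ (1 - δ) = s ^ δ ≤ 4`. -/
lemma div_rpow_one_sub_le_four {s δ : ℝ} (hs : 0 < s) (hs4 : s ≤ 4) (h0 : 0 ≤ δ) (h1 : δ ≤ 1) :
    s / s ^ (1 - δ) ≤ 4 := by
  have key : s / s ^ (1 - δ) = s ^ δ := by
    rw [Real.rpow_sub hs, Real.rpow_one, div_div_cancel₀ hs.ne']
  calc s / s ^ (1 - δ) = s ^ δ := key
    _ ≤ 4 ^ δ := Real.rpow_le_rpow hs.le hs4 h0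
    _ ≤ 4 ^ (1 : ℝ) := Real.rpow_le_rpow_of_exponent_le (by norm_num) h1
    _ = 4 := Real.rpow_one 4

/-- Each summand is at most `8 / n * n ^ (2δ - 2)`. -/
lemma eigen_term_power_bound {n x δ : ℝ} (hn : 0 < n) (hx : 0 < Real.sin x)
    (h0 : 0 ≤ δ) (h1 : δ ≤ 1) :
    (Real.sqrt (2 / n) * Real.sin (2 * x)) ^ 2 / (4 * n ^ 2 * Real.sin x ^ 2) ^ (1 - δ)
      ≤ 8 / n * n ^ (2 * δ - 2) := by
  have hs : 0 < 4 * Real.sin x ^ 2 := by positivity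
  have hnum : (Real.sqrt (2 / n) * Real.sin (2 * x)) ^ 2 ≤ 2 / n * (4 * Real.sin x ^ 2) := by
    rw [mul_pow, Real.sq_sqrt (by positivity), Real.sin_two_mul]
    gcongr
    nlinarith [mul_nonneg (sq_nonneg (Real.sin x)) (sub_nonneg.2 (Real.cos_sq_le_one x))]
  have hden : (4 * n ^ 2 * Real.sin x ^ 2) ^ (1 - δ)
      = (n ^ (2 * δ - 2))⁻¹ * (4 * Real.sin x ^ 2) ^ (1 - δ) := by
    rw [show 4 * n ^ 2 * Real.sin x ^ 2 = n ^ 2 * (4 * Real.sin x ^ 2) by ring,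
      Real.mul_rpow (by positivity) hs.le, ← Real.rpow_natCast n 2, ← Real.rpow_mul hn.le,
      ← Real.rpow_neg hn.le]
    congr 2
    push_cast
    ring
  have hs4 : 4 * Real.sin x ^ 2 ≤ 4 := by linarith [Real.sin_sq_le_one x]
  rw [hden]
  calc _ ≤ 2 / n * (4 * Real.sin x ^ 2)
          / ((n ^ (2 * δ - 2))⁻¹ * (4 * Real.sin x ^ 2) ^ (1 - δ)) := by gcongr
    _ = 2 / n * n ^ (2 * δ - 2) * (4 * Real.sin x ^ 2 / (4 * Real.sin x ^ 2) ^ (1 - δ)) := by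
      field_simp
    _ ≤ 2 / n * n ^ (2 * δ - 2) * 4 := by
      gcongr
      exact div_rpow_one_sub_le_four hs hs4 h0 h1
    _ = 8 / n * n ^ (2 * δ - 2) := by ring

/-- There is a universal constant `C` such that for every `n ≥ 2` and every
`δ ∈ [0,1]`, `Σ_{ℓ=1}^{n−1} (v_ℓ^n(1))² / (λ_ℓ^n)^{1−δ} ≤ C n^{2δ−2}`, where
`v_ℓ^n(1) = √(2/n) sin(πℓ/n)` and `λ_ℓ^n = 4n² sin²(πℓ/(2n))`. -/
theorem eigen_sum_power_bound :
    ∃ C : ℝ, 0 < C ∧ ∀ n : ℕ, 2 ≤ n → ∀ δ : ℝ, δ ∈ Set.Icc (0 : ℝ) 1 →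
      (∑ ℓ ∈ Finset.Icc 1 (n - 1),
          (Real.sqrt (2 / n) * Real.sin (Real.pi * ℓ / n)) ^ 2
            / (4 * (n : ℝ) ^ 2 * Real.sin (Real.pi * ℓ / (2 * n)) ^ 2) ^ (1 - δ))
        ≤ C * (n : ℝ) ^ (2 * δ - 2) := by
  refine ⟨8, by norm_num, fun n hn δ hδ => ?_⟩
  have hn0 : (0 : ℝ) < n := by exact_mod_cast (by omega : 0 < n)
  refine (Finset.sum_le_card_nsmul _ _ (8 / n * (n : ℝ) ^ (2 * δ - 2)) fun ℓ hℓ => ?_).trans ?_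
  · rw [Finset.mem_Icc] at hℓ
    have hℓ0 : (0 : ℝ) < ℓ := by exact_mod_cast (by omega : 0 < ℓ)
    have hℓn : (ℓ : ℝ) < 2 * n := by exact_mod_cast (by omega : ℓ < 2 * n)
    have hsin : 0 < Real.sin (Real.pi * ℓ / (2 * n)) := by
      apply Real.sin_pos_of_pos_of_lt_pi
      · positivity
      · rw [div_lt_iff₀ (by positivity)]
        gcongr
    rw [show Real.pi * ℓ / n = 2 * (Real.pi * ℓ / (2 * n)) by field_simp]
    exact eigen_term_power_bound hn0 hsin hδ.1 hδ.2
  · rw [Nat.card_Icc, nsmul_eq_mul, Nat.add_sub_cancel]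
    calc ((n - 1 : ℕ) : ℝ) * (8 / n * (n : ℝ) ^ (2 * δ - 2))
        ≤ n * (8 / n * (n : ℝ) ^ (2 * δ - 2)) := by
          gcongr
          exact Nat.sub_le n 1
      _ = 8 * (n : ℝ) ^ (2 * δ - 2) := by field_simp
end

section
/- Let n ≥ 4 be an integer and θ ≥ 0 real, and let D_n = {(z,z+1): z = 1,…,n−2} ⊂ V_n be the diagonal. Suppose T: V_n ∪ ∂V_n → ℝ satisfies (𝒜_n^θ T)(u) = −1 for u ∈ D_n, (𝒜_n^θ T)(u) = 0 for u ∈ V_n \ D_n, and T ≡ 0 on ∂V_n. Then T(x,y) ≤ x(n−y)/(n−1) + n^θ for every (x,y) ∈ V_n. Moreover, when θ = 0 the unique such function is exactly T(x,y) = x(n−y)/(n−1). -/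
lemma cRate_eq_one {n : ℕ} {θ : ℝ} {a b : ℕ} (ha : 0 < a) (hab : a < b) (hb : b < n) :
    cRate n θ (a, b) = 1 := by
  simp [cRate, ha, hab, hb]

lemma cRate_boundary {n : ℕ} {θ : ℝ} {a b : ℕ} (ha : a ≤ n) (hb : b ≤ n)
    (h : a = 0 ∨ b = n) : cRate n θ (a, b) = (n : ℝ) ^ (-θ) := by
  have h' : ¬ (0 < a ∧ a < b ∧ b < n) := by omega
  simp only [cRate, h', if_false]
  rw [if_pos ⟨ha, hb, h⟩]

lemma cRate_eq_zero {n : ℕ} {θ : ℝ} {a : ℕ} (ha : 0 < a) (han : a < n) :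
    cRate n θ (a, a) = 0 := by
  simp only [cRate]
  rw [if_neg (by omega), if_neg (by omega)]

lemma cRate_nonneg (n : ℕ) (θ : ℝ) (v : ℕ × ℕ) : 0 ≤ cRate n θ v := by
  unfold cRate
  split_ifs <;> positivity

lemma cRate_pred_pos {n : ℕ} {θ : ℝ} {x y : ℕ} (hx : 0 < x) (hxy : x < y) (hy : y < n) :
    0 < cRate n θ (x - 1, y) := by
  have hn : (0 : ℝ) < n := by exact_mod_cast (by omega : 0 < n)
  by_cases h : x = 1
  · rw [cRate_boundary (by omega) hy.le (by omega)]
    positivity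
  · rw [cRate_eq_one (by omega) (by omega) hy]
    exact one_pos

/-- A nonnegative rate times an increment is nonpositive when the increment leads to a point
of `V_n ∪ ∂V_n` where `f` does not exceed its current value. -/
lemma cRate_mul_nonpos {n : ℕ} {θ : ℝ} {f : ℕ × ℕ → ℝ} {M : ℝ} (hM : 0 ≤ M)
    (hB : ∀ x y : ℕ, x ≤ n → y ≤ n → (x = 0 ∨ y = n) → f (x, y) ≤ 0)
    (hV : ∀ x y : ℕ, 0 < x → x < y → y < n → f (x, y) ≤ M) (a b : ℕ) :
    cRate n θ (a, b) * (f (a, b) - M) ≤ 0 := by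
  by_cases h : 0 < a ∧ a < b ∧ b < n
  · exact mul_nonpos_of_nonneg_of_nonpos (cRate_nonneg _ _ _)
      (by linarith [hV a b h.1 h.2.1 h.2.2])
  · by_cases h' : a ≤ n ∧ b ≤ n ∧ (a = 0 ∨ b = n)
    · exact mul_nonpos_of_nonneg_of_nonpos (cRate_nonneg _ _ _)
        (by linarith [hB a b h'.1 h'.2.1 h'.2.2])
    · simp [cRate, h, h']

/-- The maximum principle for `𝒜_n^θ`. -/
lemma nonpos_of_Aop_nonneg {n : ℕ} {θ : ℝ} {f : ℕ × ℕ → ℝ}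
    (hA : ∀ x y : ℕ, 0 < x → x < y → y < n → 0 ≤ Aop n θ f (x, y))
    (hB : ∀ x y : ℕ, x ≤ n → y ≤ n → (x = 0 ∨ y = n) → f (x, y) ≤ 0)
    {x y : ℕ} (hx : 0 < x) (hxy : x < y) (hy : y < n) : f (x, y) ≤ 0 := by
  classical
  by_contra! hpos
  let V : Finset (ℕ × ℕ) :=
    (Finset.range n ×ˢ Finset.range n).filter fun p => 0 < p.1 ∧ p.1 < p.2
  have mem_V : ∀ a b : ℕ, (a, b) ∈ V ↔ 0 < a ∧ a < b ∧ b < n := by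
    intro a b
    simp only [V, Finset.mem_filter, Finset.mem_product, Finset.mem_range]
    omega
  obtain ⟨⟨a, b⟩, hab, hmax⟩ := V.exists_max_image f ⟨(x, y), (mem_V x y).2 ⟨hx, hxy, hy⟩⟩
  set M := f (a, b)
  have hM : 0 < M := hpos.trans_le (hmax _ ((mem_V x y).2 ⟨hx, hxy, hy⟩))
  have hV : ∀ x y : ℕ, 0 < x → x < y → y < n → f (x, y) ≤ M := fun x y h1 h2 h3 =>
    hmax _ ((mem_V x y).2 ⟨h1, h2, h3⟩)
  have hlt : ∀ k l : ℕ, k < l → l < n → f (k, l) < M := by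
    intro k
    induction k with
    | zero => exact fun l _ hl => (hB 0 l (by omega) hl.le (Or.inl rfl)).trans_lt hM
    | succ k ih =>
      intro l hkl hl
      refine (hV _ _ k.succ_pos hkl hl).lt_of_ne fun heq => ?_
      have h := hA (k + 1) l k.succ_pos hkl hl
      simp only [Aop, heq] at h
      have h1 := cRate_mul_nonpos (θ := θ) hM.le hB hV (k + 1 + 1) l
      have h2 := cRate_mul_nonpos (θ := θ) hM.le hB hV (k + 1) (l + 1)
      have h3 := cRate_mul_nonpos (θ := θ) hM.le hB hV (k + 1) (l - 1)
      have h4 := mul_neg_of_pos_of_neg (cRate_pred_pos (θ := θ) k.succ_pos hkl hl)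
        (sub_neg.2 (ih l (by omega) hl))
      simp only [Nat.add_sub_cancel, Nat.succ_eq_add_one] at h h4
      linarith
  obtain ⟨-, h2, h3⟩ := (mem_V a b).1 hab
  exact (hlt a b h2 h3).ne rfl

/-- The comparison principle for `𝒜_n^θ`. -/
lemma le_of_Aop_le {n : ℕ} {θ : ℝ} {f g : ℕ × ℕ → ℝ}
    (hA : ∀ x y : ℕ, 0 < x → x < y → y < n → Aop n θ g (x, y) ≤ Aop n θ f (x, y))
    (hB : ∀ x y : ℕ, x ≤ n → y ≤ n → (x = 0 ∨ y = n) → f (x, y) ≤ g (x, y))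
    {x y : ℕ} (hx : 0 < x) (hxy : x < y) (hy : y < n) : f (x, y) ≤ g (x, y) := by
  have key := nonpos_of_Aop_nonneg (n := n) (θ := θ) (f := fun p => f p - g p)
    (fun x y h1 h2 h3 => by
      have h := hA x y h1 h2 h3
      simp only [Aop] at h ⊢
      linarith)
    (fun x y h1 h2 h3 => by linarith [hB x y h1 h2 h3]) hx hxy hy
  linarith [key]

/-- The function `x(n−y)/(n−1)`, solving the problem for `θ = 0`. -/
noncomputable def bilin (n : ℕ) (p : ℕ × ℕ) : ℝ :=
  (p.1 : ℝ) * ((n : ℝ) - p.2) / ((n : ℝ) - 1)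

lemma bilin_boundary {n x y : ℕ} (h : x = 0 ∨ y = n) : bilin n (x, y) = 0 := by
  rcases h with rfl | rfl <;> simp [bilin]

lemma bilin_nonneg {n x y : ℕ} (hn : 1 ≤ n) (hy : y ≤ n) : 0 ≤ bilin n (x, y) := by
  have h1 : (1 : ℝ) ≤ n := by exact_mod_cast hn
  have h2 : (y : ℝ) ≤ n := by exact_mod_cast hy
  exact div_nonneg (mul_nonneg (Nat.cast_nonneg _) (by linarith)) (by linarith)

lemma Aop_zero_bilin {n x y : ℕ} (hx : 0 < x) (hxy : x < y) (hy : y < n) :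
    Aop n 0 (bilin n) (x, y) = if y = x + 1 then -1 else 0 := by
  have hn1 : (n : ℝ) - 1 ≠ 0 := by
    have : (1 : ℝ) < n := by exact_mod_cast (by omega : 1 < n)
    linarith
  have hleft : cRate n 0 (x - 1, y) = 1 := by
    by_cases h : x = 1
    · rw [cRate_boundary (by omega) hy.le (by omega)]; simp
    · exact cRate_eq_one (by omega) (by omega) hy
  have hup : cRate n 0 (x, y + 1) = 1 := by
    by_cases h : y + 1 = n
    · rw [cRate_boundary (by omega) (by omega) (by omega)]; simp
    · exact cRate_eq_one hx (by omega) (by omega)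
  have hx' : ((x - 1 : ℕ) : ℝ) = x - 1 := by push_cast [Nat.cast_sub (show 1 ≤ x from hx)]; ring
  have hy' : ((y - 1 : ℕ) : ℝ) = y - 1 := by
    push_cast [Nat.cast_sub (show 1 ≤ y by omega)]; ring
  simp only [Aop, hleft, hup]
  split_ifs with h
  · subst h
    rw [cRate_eq_zero (by omega) hy, Nat.add_sub_cancel, cRate_eq_zero hx (by omega)]
    simp only [bilin, hx']
    push_cast
    field_simp
    ring
  · rw [cRate_eq_one (by omega) (by omega) hy, cRate_eq_one hx (by omega) (by omega)]
    simp only [bilin, hx', hy']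
    push_cast
    field_simp
    ring

/-- The barrier `x(n−y)/(n−1) + n^θ` on `V_n`, extended by zero to `∂V_n`. -/
noncomputable def barrier (n : ℕ) (θ : ℝ) (p : ℕ × ℕ) : ℝ :=
  if p.1 = 0 ∨ p.2 = n then 0 else bilin n p + (n : ℝ) ^ θ

lemma barrier_boundary {n : ℕ} {θ : ℝ} {x y : ℕ} (h : x = 0 ∨ y = n) :
    barrier n θ (x, y) = 0 :=
  if_pos h

lemma barrier_interior {n : ℕ} {θ : ℝ} {x y : ℕ} (hx : 0 < x) (hy : y < n) :
    barrier n θ (x, y) = bilin n (x, y) + (n : ℝ) ^ θ :=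
  if_neg (by simp only; omega)

/-- Towards a boundary site the barrier drops at rate at least one. -/
lemma cRate_mul_barrier_le {n : ℕ} {θ : ℝ} {x y a b : ℕ} (hx : 0 < x) (hy : y < n)
    (ha : a ≤ n) (hb : b ≤ n) (hab : a = 0 ∨ b = n) :
    cRate n θ (a, b) * (barrier n θ (a, b) - barrier n θ (x, y)) ≤ -1 := by
  have hn : (0 : ℝ) < n := by exact_mod_cast (by omega : 0 < n)
  rw [cRate_boundary ha hb hab, barrier_boundary hab, barrier_interior hx hy]
  have h1 : (n : ℝ) ^ (-θ) * (n : ℝ) ^ θ = 1 := by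
    rw [← Real.rpow_add hn]; simp
  have h2 : 0 ≤ (n : ℝ) ^ (-θ) * bilin n (x, y) :=
    mul_nonneg (by positivity) (bilin_nonneg (by omega) hy.le)
  linarith

/-- Jump by jump, the barrier has smaller drift than the solution for `θ = 0`. -/
lemma cRate_mul_barrier_le_bilin {n : ℕ} {θ : ℝ} {x y a b : ℕ} (hx : 0 < x)
    (hy : y < n) (ha : a ≤ n) (hb : b ≤ n)
    (hle : -1 ≤ bilin n (a, b) - bilin n (x, y)) :
    cRate n θ (a, b) * (barrier n θ (a, b) - barrier n θ (x, y)) ≤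
      cRate n 0 (a, b) * (bilin n (a, b) - bilin n (x, y)) := by
  by_cases hab : a = 0 ∨ b = n
  · refine (cRate_mul_barrier_le hx hy ha hb hab).trans ?_
    rw [cRate_boundary ha hb hab]
    simpa using hle
  · rw [barrier_interior (by omega) (by omega), barrier_interior hx hy]
    refine le_of_eq ?_
    simp [cRate, hab]

lemma Aop_barrier_le {n : ℕ} {θ : ℝ} {x y : ℕ} (hx : 0 < x) (hxy : x < y) (hy : y < n) :
    Aop n θ (barrier n θ) (x, y) ≤ if y = x + 1 then -1 else 0 := by
  rw [← Aop_zero_bilin hx hxy hy]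
  have hx1 : (1 : ℝ) ≤ x := by exact_mod_cast hx
  have hxy1 : (x : ℝ) + 1 ≤ y := by exact_mod_cast hxy
  have hyn : (y : ℝ) + 1 ≤ n := by exact_mod_cast hy
  have hn1 : (0 : ℝ) < (n : ℝ) - 1 := by linarith
  have hx' : ((x - 1 : ℕ) : ℝ) = x - 1 := by push_cast [Nat.cast_sub (show 1 ≤ x from hx)]; ring
  have hy' : ((y - 1 : ℕ) : ℝ) = y - 1 := by
    push_cast [Nat.cast_sub (show 1 ≤ y by omega)]; ring
  unfold Aop
  refine add_le_add (add_le_add (add_le_add ?_ ?_) ?_) ?_ <;>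
    refine cRate_mul_barrier_le_bilin hx hy (by simp only; omega) (by simp only; omega) ?_ <;>
    simp only [bilin, hx', hy'] <;>
    rw [← sub_div, le_div_iff₀ hn1] <;>
    push_cast <;>
    linarith

/-- If `T` solves `𝒜_n^θ T = −1` on the diagonal `D_n = {(z,z+1) : 1 ≤ z ≤ n−2}`,
`𝒜_n^θ T = 0` on `V_n \ D_n`, and `T = 0` on `∂V_n`, then
`T(x,y) ≤ x(n−y)/(n−1) + n^θ` on `V_n`; moreover for `θ = 0` necessarily
`T(x,y) = x(n−y)/(n−1)`. -/
theorem diagonal_occupation_time_bound (n : ℕ) (hn : 4 ≤ n) (θ : ℝ) (hθ : 0 ≤ θ)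
    (T : ℕ × ℕ → ℝ)
    (hTD : ∀ z : ℕ, 1 ≤ z → z ≤ n - 2 → Aop n θ T (z, z + 1) = -1)
    (hTV : ∀ x y : ℕ, 0 < x → x < y → y < n → y ≠ x + 1 → Aop n θ T (x, y) = 0)
    (hTB : ∀ x y : ℕ, x ≤ n → y ≤ n → (x = 0 ∨ y = n) → T (x, y) = 0) :
    (∀ x y : ℕ, 0 < x → x < y → y < n →
      T (x, y) ≤ (x : ℝ) * ((n : ℝ) - y) / ((n : ℝ) - 1) + (n : ℝ) ^ θ) ∧
    (θ = 0 → ∀ x y : ℕ, 0 < x → x < y → y < n →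
      T (x, y) = (x : ℝ) * ((n : ℝ) - y) / ((n : ℝ) - 1)) := by
  have hT : ∀ x y : ℕ, 0 < x → x < y → y < n →
      Aop n θ T (x, y) = if y = x + 1 then -1 else 0 := by
    intro x y hx hxy hy
    split_ifs with h
    · subst h
      exact hTD x hx (by omega)
    · exact hTV x y hx hxy hy h
  refine ⟨fun x y hx hxy hy => ?_, ?_⟩
  · have h := le_of_Aop_le (f := T) (g := barrier n θ) (θ := θ)
      (fun x y h1 h2 h3 => (Aop_barrier_le h1 h2 h3).trans (hT x y h1 h2 h3).ge)
      (fun x y h1 h2 h3 => by rw [hTB x y h1 h2 h3, barrier_boundary h3]) hx hxy hy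
    rwa [barrier_interior hx hy] at h
  · rintro rfl x y hx hxy hy
    have hA : ∀ x y : ℕ, 0 < x → x < y → y < n →
        Aop n 0 T (x, y) = Aop n 0 (bilin n) (x, y) := fun x y h1 h2 h3 => by
      rw [hT x y h1 h2 h3, Aop_zero_bilin h1 h2 h3]
    have hB : ∀ x y : ℕ, x ≤ n → y ≤ n → (x = 0 ∨ y = n) → T (x, y) = bilin n (x, y) :=
      fun x y h1 h2 h3 => by rw [hTB x y h1 h2 h3, bilin_boundary h3]
    exact le_antisymm
      (le_of_Aop_le (fun x y h1 h2 h3 => (hA x y h1 h2 h3).ge)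
        (fun x y h1 h2 h3 => (hB x y h1 h2 h3).le) hx hxy hy)
      (le_of_Aop_le (fun x y h1 h2 h3 => (hA x y h1 h2 h3).le)
        (fun x y h1 h2 h3 => (hB x y h1 h2 h3).ge) hx hxy hy)
end
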